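/- arXiv:0903.4521 — 2 statements merged into one kernel-verified Lean document; each statement's English description precedes it below -/
import Mathlib

section
/- Let j ≥ i ≥ 2 be integers, let G be a finite simple K_{i,j}-free graph, and let B be a set of b vertices of G. Then the number of vertices v of G with v ∉ B that have at least i neighbors in B is at most (j−1)·C(b, i), where C(b, i) denotes the binomial coefficient b choose i. -/
/-- `G` contains `K_{i,j}` as a subgraph: there are disjoint vertex sets `A`, `B` with
`|A| = i`, `|B| = j` and every vertex of `A` adjacent to every vertex of `B`. -/
def ContainsKij {V : Type*} (G : SimpleGraph V) (i j : ℕ) : Prop :=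
  ∃ A B : Finset V, A.card = i ∧ B.card = j ∧ Disjoint A B ∧
    ∀ a ∈ A, ∀ b ∈ B, G.Adj a b

/-- `G` is `K_{i,j}`-free. -/
def KijFree {V : Type*} (G : SimpleGraph V) (i j : ℕ) : Prop := ¬ ContainsKij G i j

/-- In a `K_{i,j}`-free graph, fewer than `j` vertices outside a set `s` of `i` vertices are
adjacent to all of `s`. -/
theorem KijFree.card_lt_of_forall_adj {V : Type*} {G : SimpleGraph V} {i j : ℕ}
    (hfree : KijFree G i j) {s t : Finset V} (hs : s.card = i) (hst : Disjoint s t)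
    (hadj : ∀ v ∈ t, ∀ w ∈ s, G.Adj v w) : t.card < j := by
  by_contra! hj
  obtain ⟨u, hut, hu⟩ := Finset.exists_subset_card_eq hj
  exact hfree ⟨s, u, hs, hu, hst.mono_right hut, fun a ha b hb => (hadj b (hut hb) a ha).symm⟩

theorem stmt5 {V : Type*} [Fintype V] [DecidableEq V]
    (G : SimpleGraph V) [DecidableRel G.Adj]
    (i j : ℕ) (hi : 2 ≤ i) (hij : i ≤ j) (hfree : KijFree G i j)
    (B : Finset V) (b : ℕ) (hb : B.card = b) :
    (Finset.univ.filter
        (fun v : V => v ∉ B ∧ i ≤ (B.filter (fun w => G.Adj v w)).card)).card ≤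
      (j - 1) * b.choose i := by
  set S := Finset.univ.filter
    (fun v : V => v ∉ B ∧ i ≤ (B.filter (fun w => G.Adj v w)).card) with hS
  have hex : ∀ v : V, ∃ s : Finset V, v ∈ S →
      s ⊆ B ∧ s.card = i ∧ ∀ w ∈ s, G.Adj v w := by
    intro v
    by_cases hv : v ∈ S
    · obtain ⟨s, hs, hcard⟩ := Finset.exists_subset_card_eq (Finset.mem_filter.1 hv).2.2
      exact ⟨s, fun _ => ⟨hs.trans (Finset.filter_subset _ _), hcard,
        fun w hw => (Finset.mem_filter.1 (hs hw)).2⟩⟩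
    · exact ⟨∅, fun h => absurd h hv⟩
  choose f hf using hex
  rw [← hb, ← Finset.card_powersetCard]
  refine Finset.card_le_mul_card_image_of_maps_to (f := f)
    (fun v hv => Finset.mem_powersetCard.2 ⟨(hf v hv).1, (hf v hv).2.1⟩) (j - 1) ?_
  intro s hs
  obtain ⟨hsB, hcard⟩ := Finset.mem_powersetCard.1 hs
  refine Nat.le_sub_one_of_lt (hfree.card_lt_of_forall_adj hcard ?_ ?_)
  · refine Finset.disjoint_left.2 fun w hw hwS => ?_
    exact (Finset.mem_filter.1 (Finset.mem_filter.1 hwS).1).2.1 (hsB hw)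
  · intro v hv w hw
    obtain ⟨hvS, rfl⟩ := Finset.mem_filter.1 hv
    exact (hf v hvS).2.2 w hw
end

section
/- Let j ≥ i ≥ 2 be integers, let G be a finite simple K_{i,j}-free graph, and let B be a set of b vertices of G with b ≥ 2. Let W be a set of vertices of G disjoint from B such that every vertex of W has at least two neighbors in B, and such that no two distinct vertices of W have exactly the same set of neighbors in B. Then |W| ≤ 2·b^{i−1} + (j−1)·b^{i}. -/
/-- There are at most `b ^ n` distinct nonempty subsets of size at most `n` of a `b`-element
set: each of them is the range of a function on `Fin n`. -/
theorem Finset.card_le_pow_of_forall_card_le {V : Type*} [DecidableEq V] (B : Finset V) (n : ℕ)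
    (S : Finset (Finset V)) (hsub : ∀ s ∈ S, s ⊆ B) (hne : ∀ s ∈ S, s.Nonempty)
    (hcard : ∀ s ∈ S, s.card ≤ n) : S.card ≤ B.card ^ n := by
  have hS : S ⊆ (Fintype.piFinset fun _ : Fin n => B).image fun f => Finset.univ.image f := by
    intro s hs
    obtain ⟨e⟩ : Nonempty (s ↪ Fin n) :=
      Function.Embedding.nonempty_of_card_le (by simpa using hcard s hs)
    have : Nonempty s := (hne s hs).to_subtype
    obtain ⟨g, hsurj⟩ : ∃ g : Fin n → s, Function.Surjective g :=
      ⟨_, Function.invFun_surjective e.injective⟩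
    refine Finset.mem_image.2 ⟨fun k => (g k : V), ?_, ?_⟩
    · exact Fintype.mem_piFinset.2 fun k => hsub s hs (g k).2
    · ext x
      simp only [Finset.mem_image, Finset.mem_univ, true_and]
      constructor
      · rintro ⟨k, rfl⟩
        exact (g k).2
      · intro hx
        obtain ⟨k, hk⟩ := hsurj ⟨x, hx⟩
        exact ⟨k, by rw [hk]⟩
  calc S.card ≤ _ := Finset.card_le_card hS
    _ ≤ _ := Finset.card_image_le
    _ = B.card ^ n := by simp

/-- In a `K_{i,j}`-free graph, a set of vertices all adjacent to `i` common vertices outside of it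
has fewer than `j` elements. -/
theorem KijFree.card_lt {V : Type*} {G : SimpleGraph V} {i j : ℕ} (hfree : KijFree G i j)
    {A C : Finset V} (hA : A.card = i) (hdisj : Disjoint A C)
    (hadj : ∀ a ∈ A, ∀ c ∈ C, G.Adj a c) : C.card < j := by
  by_contra! hj
  obtain ⟨D, hDC, hD⟩ := Finset.exists_subset_card_eq hj
  exact hfree ⟨A, D, hA, hD, hdisj.mono_right hDC, fun a ha d hd => hadj a ha d (hDC hd)⟩

/-- In a `K_{i,j}`-free graph, at most `(j - 1) * b ^ i` vertices outside a set `B` of size `b`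
have at least `i` neighbors in `B`. -/
theorem KijFree.card_le_of_forall_le_card_filter_adj {V : Type*} [DecidableEq V]
    {G : SimpleGraph V} [DecidableRel G.Adj] {i j : ℕ} (hfree : KijFree G i j)
    (B W : Finset V) (hdisj : Disjoint W B)
    (hW : ∀ w ∈ W, i ≤ (B.filter (fun x => G.Adj w x)).card) :
    W.card ≤ (j - 1) * B.card ^ i := by
  have hex : ∀ w, ∃ A : Finset V, w ∈ W → A ⊆ B.filter (fun x => G.Adj w x) ∧ A.card = i := by
    intro w
    by_cases hw : w ∈ W
    · obtain ⟨A, hA⟩ := Finset.exists_subset_card_eq (hW w hw)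
      exact ⟨A, fun _ => hA⟩
    · exact ⟨∅, fun h => absurd h hw⟩
  choose f hf using hex
  have hmaps : ∀ w ∈ W, f w ∈ B.powersetCard i := fun w hw =>
    Finset.mem_powersetCard.2 ⟨(hf w hw).1.trans (Finset.filter_subset _ _), (hf w hw).2⟩
  have hfib : ∀ A ∈ B.powersetCard i, (W.filter fun w => f w = A).card ≤ j - 1 := by
    intro A hA
    obtain ⟨hAB, hAi⟩ := Finset.mem_powersetCard.1 hA
    refine Nat.le_sub_one_of_lt (hfree.card_lt hAi ?_ ?_)
    · exact (hdisj.mono (Finset.filter_subset _ _) hAB).symm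
    · intro a ha w hw
      obtain ⟨hwW, rfl⟩ := Finset.mem_filter.1 hw
      exact (Finset.mem_filter.1 ((hf w hwW).1 ha)).2.symm
  calc W.card ≤ (j - 1) * (B.powersetCard i).card :=
        Finset.card_le_mul_card_image_of_maps_to hmaps _ hfib
    _ ≤ (j - 1) * B.card ^ i := by
        rw [Finset.card_powersetCard]
        exact Nat.mul_le_mul_left _ (Nat.choose_le_pow _ _)

theorem stmt6 {V : Type*} [Fintype V] [DecidableEq V]
    (G : SimpleGraph V) [DecidableRel G.Adj]
    (i j : ℕ) (hi : 2 ≤ i) (hij : i ≤ j) (hfree : KijFree G i j)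
    (B W : Finset V) (b : ℕ) (hb : B.card = b) (hb2 : 2 ≤ b)
    (hdisj : Disjoint W B)
    (htwo : ∀ w ∈ W, 2 ≤ (B.filter (fun x => G.Adj w x)).card)
    (hdistinct : ∀ w₁ ∈ W, ∀ w₂ ∈ W, w₁ ≠ w₂ →
      B.filter (fun x => G.Adj w₁ x) ≠ B.filter (fun x => G.Adj w₂ x)) :
    W.card ≤ 2 * b ^ (i - 1) + (j - 1) * b ^ i := by
  subst hb
  let N : V → Finset V := fun w => B.filter (fun x => G.Adj w x)
  have hlarge : (W.filter fun w => i ≤ (N w).card).card ≤ (j - 1) * B.card ^ i :=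
    hfree.card_le_of_forall_le_card_filter_adj B _
      (hdisj.mono_left (Finset.filter_subset _ _)) fun w hw => (Finset.mem_filter.1 hw).2
  have hinj : Set.InjOn N (W.filter fun w => ¬ i ≤ (N w).card) := by
    intro w₁ h₁ w₂ h₂ h
    by_contra hne
    exact hdistinct w₁ (Finset.mem_filter.1 h₁).1 w₂ (Finset.mem_filter.1 h₂).1 hne h
  have hsmall : (W.filter fun w => ¬ i ≤ (N w).card).card ≤ B.card ^ (i - 1) := by
    rw [← Finset.card_image_of_injOn hinj]
    apply Finset.card_le_pow_of_forall_card_le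
    · exact Finset.forall_mem_image.2 fun w _ => Finset.filter_subset _ _
    · refine Finset.forall_mem_image.2 fun w hw => Finset.card_pos.1 ?_
      exact lt_of_lt_of_le two_pos (htwo w (Finset.mem_filter.1 hw).1)
    · refine Finset.forall_mem_image.2 fun w hw => ?_
      have := (Finset.mem_filter.1 hw).2
      omega
  have hsplit := Finset.card_filter_add_card_filter_not (s := W) fun w => i ≤ (N w).card
  omega
end
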